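/- For every positive integer n, the domain 2^[n] is s-pure; moreover, every maximal s-collection in 2^[n] has cardinality n(n+1)/2 + 1. -/

import Mathlib

open Finset

/-- max of a finite set of naturals, with the convention `max0 ∅ = 0`. -/
def max0 (A : Finset ℕ) : ℕ := if h : A.Nonempty then A.max' h else 0

/-- min of a finite set of naturals, with the convention `min0 ∅ = 0`. -/
def min0 (A : Finset ℕ) : ℕ := if h : A.Nonempty then A.min' h else 0

/-- `A < B` : global dominating, i.e. `max A < min B` (with `min ∅ = max ∅ = 0`). -/
def SetLT (A B : Finset ℕ) : Prop := max0 A < min0 B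

/-- `A ⋖ B` : global dominating after cancelations, i.e. `(A − B) < (B − A)`. -/
def LessDot (A B : Finset ℕ) : Prop := SetLT (A \ B) (B \ A)

/-- `A ▷ B` (splitting): `A − B ≠ ∅` and `B − A` is a union of nonempty subsets
`B′, B″` with `B′ < (A − B) < B″`. -/
def Splits (A B : Finset ℕ) : Prop :=
  (A \ B).Nonempty ∧ ∃ B' B'' : Finset ℕ, B'.Nonempty ∧ B''.Nonempty ∧
    B' ∪ B'' = B \ A ∧ SetLT B' (A \ B) ∧ SetLT (A \ B) B''

/-- `A` and `B` are strongly separated. -/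
def StronglySep (A B : Finset ℕ) : Prop := LessDot A B ∨ LessDot B A ∨ A = B

/-- `A` and `B` are weakly separated. -/
def WeaklySep (A B : Finset ℕ) : Prop :=
  StronglySep A B ∨ (Splits A B ∧ B.card ≤ A.card) ∨ (Splits B A ∧ A.card ≤ B.card)

/-- a w-collection: members are pairwise weakly separated. -/
def IsWColl (F : Finset (Finset ℕ)) : Prop := ∀ A ∈ F, ∀ B ∈ F, WeaklySep A B

/-- a maximal w-collection in the domain `D`. -/
def IsMaxWColl (D : Set (Finset ℕ)) (F : Finset (Finset ℕ)) : Prop :=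
  ↑F ⊆ D ∧ IsWColl F ∧
    ∀ G : Finset (Finset ℕ), ↑G ⊆ D → IsWColl G → F ⊆ G → F = G

/-- the domain `D` is w-pure: all maximal w-collections in `D` have the same cardinality. -/
def WPure (D : Set (Finset ℕ)) : Prop :=
  ∀ F G : Finset (Finset ℕ), IsMaxWColl D F → IsMaxWColl D G → F.card = G.card

/-- an s-collection: members are pairwise strongly separated. -/
def IsSColl (F : Finset (Finset ℕ)) : Prop := ∀ A ∈ F, ∀ B ∈ F, StronglySep A B

/-- a maximal s-collection in the domain `D`. -/
def IsMaxSColl (D : Set (Finset ℕ)) (F : Finset (Finset ℕ)) : Prop :=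
  ↑F ⊆ D ∧ IsSColl F ∧
    ∀ G : Finset (Finset ℕ), ↑G ⊆ D → IsSColl G → F ⊆ G → F = G

/-- the domain `D` is s-pure: all maximal s-collections in `D` have the same cardinality. -/
def SPure (D : Set (Finset ℕ)) : Prop :=
  ∀ F G : Finset (Finset ℕ), IsMaxSColl D F → IsMaxSColl D G → F.card = G.card

/-- `A` lies strictly to the left of `B`: the two sets are incomparable under inclusion and
every element of `A \ B` is smaller than every element of `B \ A`. -/
def StrictLeft (A B : Finset ℕ) : Prop :=
  ¬ A ⊆ B ∧ ¬ B ⊆ A ∧ ∀ a ∈ A, a ∉ B → ∀ b ∈ B, b ∉ A → a < b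

/-- `A` and `B` are comparable under inclusion, or one is strictly to the left of the other. -/
def IsSep (A B : Finset ℕ) : Prop := A ⊆ B ∨ B ⊆ A ∨ StrictLeft A B ∨ StrictLeft B A

theorem IsSep.symm {A B : Finset ℕ} (h : IsSep A B) : IsSep B A := by
  unfold IsSep at *; tauto

theorem IsSep.refl (A : Finset ℕ) : IsSep A A := Or.inl (subset_refl A)

theorem lessDot_of_ssubset {A B : Finset ℕ} (hB : 0 ∉ B) (h : A ⊂ B) : LessDot A B := by
  have hne : (B \ A).Nonempty := sdiff_nonempty.2 h.2
  have hpos : (B \ A).min' hne ≠ 0 := fun h0 =>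
    hB (h0 ▸ (mem_sdiff.1 ((B \ A).min'_mem hne)).1)
  have he : A \ B = ∅ := sdiff_eq_empty_iff_subset.2 h.1
  simp only [LessDot, SetLT, max0, min0, he, hne, Finset.not_nonempty_empty, dite_true, dite_false]
  omega

theorem StrictLeft.lessDot {A B : Finset ℕ} (h : StrictLeft A B) : LessDot A B := by
  have hA : (A \ B).Nonempty := sdiff_nonempty.2 h.1
  have hB : (B \ A).Nonempty := sdiff_nonempty.2 h.2.1
  simp only [LessDot, SetLT, max0, min0, hA, hB, dite_true]
  have h1 := mem_sdiff.1 ((A \ B).max'_mem hA)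
  have h2 := mem_sdiff.1 ((B \ A).min'_mem hB)
  exact h.2.2 _ h1.1 h1.2 _ h2.1 h2.2

theorem LessDot.sep {A B : Finset ℕ} (h : LessDot A B) : IsSep A B := by
  by_cases hA : A ⊆ B
  · exact Or.inl hA
  by_cases hB : B ⊆ A
  · exact Or.inr (Or.inl hB)
  have hA' : (A \ B).Nonempty := sdiff_nonempty.2 hA
  have hB' : (B \ A).Nonempty := sdiff_nonempty.2 hB
  simp only [LessDot, SetLT, max0, min0, hA', hB', dite_true] at h
  refine Or.inr (Or.inr (Or.inl ⟨hA, hB, fun a ha hab b hb hba => ?_⟩))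
  have h1 := (A \ B).le_max' a (mem_sdiff.2 ⟨ha, hab⟩)
  have h2 := (B \ A).min'_le b (mem_sdiff.2 ⟨hb, hba⟩)
  omega

theorem stronglySep_iff_sep {A B : Finset ℕ} (hA : 0 ∉ A) (hB : 0 ∉ B) :
    StronglySep A B ↔ IsSep A B := by
  constructor
  · rintro (h | h | rfl)
    · exact h.sep
    · exact h.sep.symm
    · exact IsSep.refl _
  · intro h
    by_cases hAB : A = B
    · exact Or.inr (Or.inr hAB)
    rcases h with h | h | h | h
    · exact Or.inl (lessDot_of_ssubset hB (h.ssubset_of_ne hAB))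
    · exact Or.inr (Or.inl (lessDot_of_ssubset hA (h.ssubset_of_ne (Ne.symm hAB))))
    · exact Or.inl h.lessDot
    · exact Or.inr (Or.inl h.lessDot)

namespace StrictLeft

variable {A B C : Finset ℕ}

theorem asymm (h : StrictLeft A B) : ¬ StrictLeft B A := by
  intro h'
  obtain ⟨a, ha, hab⟩ := not_subset.1 h.1
  obtain ⟨b, hb, hba⟩ := not_subset.1 h.2.1
  exact lt_asymm (h.2.2 a ha hab b hb hba) (h'.2.2 b hb hba a ha hab)

theorem exists_lt (h : StrictLeft A B) {b : ℕ} (hb : b ∈ B) (hbA : b ∉ A) :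
    ∃ a < b, a ∈ A ∧ a ∉ B := by
  obtain ⟨a, ha, hab⟩ := not_subset.1 h.1
  exact ⟨a, h.2.2 a ha hab b hb hbA, ha, hab⟩

theorem not_cycle (hAB : StrictLeft A B) (hBC : StrictLeft B C) : ¬ StrictLeft C A := by
  intro hCA
  have key : ∀ k : ℕ, (k ∈ A ↔ k ∈ B) ∧ (k ∈ B ↔ k ∈ C) := by
    intro k
    induction k using Nat.strong_induction_on with
    | _ k ih =>
      have h1 : k ∈ B → k ∈ A := fun hk => by
        by_contra hk'
        obtain ⟨a, hlt, ha, hb⟩ := hAB.exists_lt hk hk'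
        exact hb ((ih a hlt).1.1 ha)
      have h2 : k ∈ C → k ∈ B := fun hk => by
        by_contra hk'
        obtain ⟨a, hlt, ha, hb⟩ := hBC.exists_lt hk hk'
        exact hb ((ih a hlt).2.1 ha)
      have h3 : k ∈ A → k ∈ C := fun hk => by
        by_contra hk'
        obtain ⟨a, hlt, ha, hb⟩ := hCA.exists_lt hk hk'
        exact hb ((ih a hlt).1.2 ((ih a hlt).2.2 ha))
      tauto
  exact hAB.1 fun k hk => (key k).1.1 hk

theorem trans (hAB : StrictLeft A B) (hBC : StrictLeft B C) (hAC : IsSep A C) :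
    StrictLeft A C := by
  rcases hAC with h | h | h | h
  · obtain ⟨a, ha, hab⟩ := not_subset.1 hAB.1
    obtain ⟨b, hb, hbc⟩ := not_subset.1 hBC.1
    have h1 := hBC.2.2 b hb hbc a (h ha) hab
    have h2 := hAB.2.2 a ha hab b hb (fun hb' => hbc (h hb'))
    omega
  · obtain ⟨b, hb, hba⟩ := not_subset.1 hAB.2.1
    obtain ⟨c, hc, hcb⟩ := not_subset.1 hBC.2.1
    have h1 := hBC.2.2 b hb (fun hb' => hba (h hb')) c hc hcb
    have h2 := hAB.2.2 c (h hc) hcb b hb hba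
    omega
  · exact h
  · exact absurd h (hAB.not_cycle hBC)

end StrictLeft

theorem sep_insert_insert {A B : Finset ℕ} {k : ℕ} (hA : k ∉ A) (hB : k ∉ B) :
    IsSep (insert k A) (insert k B) ↔ IsSep A B := by
  have hs : ∀ X Y : Finset ℕ, k ∉ X → (insert k X ⊆ insert k Y ↔ X ⊆ Y) := fun X Y hX =>
    insert_subset_insert_iff hX
  have hl : ∀ X Y : Finset ℕ, k ∉ X → k ∉ Y →
      (StrictLeft (insert k X) (insert k Y) ↔ StrictLeft X Y) := by
    intro X Y hX hY
    simp only [StrictLeft, hs X Y hX, hs Y X hY]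
    grind
  simp only [IsSep, hs A B hA, hs B A hB, hl A B hA hB, hl B A hB hA]

theorem sep_insert_iff {A B : Finset ℕ} {k : ℕ} (hA : ∀ a ∈ A, a < k) (hB : ∀ b ∈ B, b < k) :
    IsSep A (insert k B) ↔ IsSep A B ∧ ¬ StrictLeft B A := by
  have hkA : k ∉ A := fun h => lt_irrefl _ (hA k h)
  have hkB : k ∉ B := fun h => lt_irrefl _ (hB k h)
  have h1 : A ⊆ insert k B ↔ A ⊆ B := subset_insert_iff_of_notMem hkA
  have h2 : ¬ insert k B ⊆ A := fun h => hkA (h (mem_insert_self k B))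
  have h3 : ¬ StrictLeft (insert k B) A := fun h => by
    obtain ⟨a, ha, hak⟩ := not_subset.1 h.2.1
    have := h.2.2 k (mem_insert_self k B) hkA a ha hak
    exact lt_asymm this (hA a ha)
  have h4 : StrictLeft A (insert k B) ↔
      ¬ A ⊆ B ∧ ∀ a ∈ A, a ∉ B → ∀ b ∈ B, b ∉ A → a < b := by
    simp only [StrictLeft, h1, h2]
    grind
  constructor
  · rintro (h | h | h | h)
    · exact ⟨Or.inl (h1.1 h), fun h' => h'.2.1 (h1.1 h)⟩
    · exact absurd h h2
    · obtain ⟨hAB, hlt⟩ := h4.1 h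
      by_cases hBA : B ⊆ A
      · exact ⟨Or.inr (Or.inl hBA), fun h' => h'.1 hBA⟩
      · have hl : StrictLeft A B := ⟨hAB, hBA, hlt⟩
        exact ⟨Or.inr (Or.inr (Or.inl hl)), hl.asymm⟩
    · exact absurd h h3
  · rintro ⟨h | h | h | h, hn⟩
    · exact Or.inl (h1.2 h)
    · by_cases hAB : A ⊆ B
      · exact Or.inl (h1.2 hAB)
      · exact Or.inr (Or.inr (Or.inl (h4.2 ⟨hAB, fun a _ _ b hb hba => absurd (h hb) hba⟩)))
    · exact Or.inr (Or.inr (Or.inl (h4.2 ⟨h.1, h.2.2⟩)))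
    · exact absurd h hn

/-- `F` is a maximal family of pairwise separated subsets of `{1, …, n}`. -/
structure MaxSep (n : ℕ) (F : Finset (Finset ℕ)) : Prop where
  subset_Icc : ∀ X ∈ F, X ⊆ Icc 1 n
  sep : ∀ X ∈ F, ∀ Y ∈ F, IsSep X Y
  mem_of_sep : ∀ X ⊆ Icc 1 n, (∀ Y ∈ F, IsSep X Y) → X ∈ F

theorem IsMaxSColl.maxSep {n : ℕ} {F : Finset (Finset ℕ)}
    (h : IsMaxSColl {X : Finset ℕ | X ⊆ Icc 1 n} F) : MaxSep n F := by
  obtain ⟨hsub, hs, hmax⟩ := h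
  have hsub' : ∀ X ∈ F, X ⊆ Icc 1 n := fun X hX => hsub hX
  have h0 : ∀ X ⊆ Icc 1 n, 0 ∉ X := fun X hX h0 => by simpa using hX h0
  refine ⟨hsub', fun X hX Y hY =>
    (stronglySep_iff_sep (h0 X (hsub' X hX)) (h0 Y (hsub' Y hY))).1 (hs X hX Y hY), ?_⟩
  intro X hX hsep
  have hst : ∀ Y ∈ F, StronglySep X Y ∧ StronglySep Y X := fun Y hY =>
    ⟨(stronglySep_iff_sep (h0 X hX) (h0 Y (hsub' Y hY))).2 (hsep Y hY),
      (stronglySep_iff_sep (h0 Y (hsub' Y hY)) (h0 X hX)).2 (hsep Y hY).symm⟩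
  have heq : F = insert X F := by
    refine hmax _ ?_ ?_ (subset_insert X F)
    · intro Y hY
      rcases mem_insert.1 (mem_coe.1 hY) with rfl | hY
      · exact hX
      · exact hsub' Y hY
    · intro A hA B hB
      rcases mem_insert.1 hA with rfl | hAF <;> rcases mem_insert.1 hB with rfl | hBF
      · exact Or.inr (Or.inr rfl)
      · exact (hst B hBF).1
      · exact (hst A hAF).2
      · exact hs A hAF B hBF
  rw [heq]
  exact mem_insert_self X F

/-- Inclusion gaps of size at least two in `F` are never empty. -/
def GapFree (F : Finset (Finset ℕ)) : Prop :=
  ∀ X ∈ F, ∀ Y ∈ F, X ⊆ Y → X.card + 2 ≤ Y.card → ∃ Z ∈ F, X ⊂ Z ∧ Z ⊂ Y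

/-- A maximal inclusion chain of a gap-free maximal family meets every level. -/
theorem MaxSep.exists_card_eq {n : ℕ} {G C : Finset (Finset ℕ)} (hG : MaxSep n G)
    (hgap : GapFree G) (hCG : C ⊆ G) (hchain : ∀ X ∈ C, ∀ Y ∈ C, X ⊆ Y ∨ Y ⊆ X)
    (hmax : ∀ Z ∈ G, (∀ X ∈ C, X ⊆ Z ∨ Z ⊆ X) → Z ∈ C) {k : ℕ} (hk : k ≤ n) :
    ∃ X ∈ C, X.card = k := by
  have hempty : ∅ ∈ C := hmax _
    (hG.mem_of_sep _ (empty_subset _) fun Y _ => Or.inl (empty_subset _))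
    fun X _ => Or.inr (empty_subset _)
  have hfull : Icc 1 n ∈ C := hmax _
    (hG.mem_of_sep _ (subset_refl _) fun Y hY => Or.inr (Or.inl (hG.subset_Icc Y hY)))
    fun X hX => Or.inl (hG.subset_Icc X (hCG hX))
  by_contra! hno
  obtain ⟨A, hA, hAmax⟩ := exists_max_image (C.filter fun X => X.card < k) card
    ⟨∅, mem_filter.2 ⟨hempty, by have := hno ∅ hempty; simp at *; omega⟩⟩
  obtain ⟨B, hB, hBmin⟩ := exists_min_image (C.filter fun X => k < X.card) card
    ⟨Icc 1 n, mem_filter.2 ⟨hfull, by have := hno _ hfull; simp at *; omega⟩⟩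
  rw [mem_filter] at hA hB
  have sub_of_lt : ∀ X ∈ C, ∀ Y ∈ C, X.card ≤ Y.card → X ⊆ Y := fun X hX Y hY hc => by
    rcases hchain X hX Y hY with h | h
    · exact h
    · exact (eq_of_subset_of_card_le h hc).ge
  obtain ⟨Z, hZ, hAZ, hZB⟩ := hgap A (hCG hA.1) B (hCG hB.1)
    (sub_of_lt A hA.1 B hB.1 (by omega)) (by omega)
  have hZC : Z ∈ C := hmax Z hZ fun X hX => by
    rcases lt_trichotomy X.card k with h | h | h
    · exact Or.inl ((sub_of_lt X hX A hA.1 (hAmax X (mem_filter.2 ⟨hX, h⟩))).trans hAZ.1)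
    · exact absurd h (hno X hX)
    · exact Or.inr (hZB.1.trans (sub_of_lt B hB.1 X hX (hBmin X (mem_filter.2 ⟨hX, h⟩))))
  have h1 := card_lt_card hAZ
  have h2 := card_lt_card hZB
  rcases lt_trichotomy Z.card k with h | h | h
  · have := hAmax Z (mem_filter.2 ⟨hZC, h⟩)
    omega
  · exact hno Z hZC h
  · have := hBmin Z (mem_filter.2 ⟨hZC, h⟩)
    omega

theorem card_eq_of_chain {n : ℕ} {C : Finset (Finset ℕ)}
    (hsub : ∀ X ∈ C, X ⊆ Icc 1 n) (hchain : ∀ X ∈ C, ∀ Y ∈ C, X ⊆ Y ∨ Y ⊆ X)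
    (hlevel : ∀ k ≤ n, ∃ X ∈ C, X.card = k) : C.card = n + 1 := by
  have himg : C.image card = range (n + 1) := by
    ext k
    simp only [mem_image, mem_range]
    constructor
    · rintro ⟨X, hX, rfl⟩
      have := card_le_card (hsub X hX)
      simp at this
      omega
    · intro hk
      exact hlevel k (by omega)
  rw [← card_range (n + 1), ← himg, card_image_of_injOn]
  intro X hX Y hY hXY
  rcases hchain X hX Y hY with h | h
  · exact eq_of_subset_of_card_le h hXY.ge
  · exact (eq_of_subset_of_card_le h hXY.le).symm

/-- The members of `F` that are subsets of `{1, …, m}`. -/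
def lowerPart (m : ℕ) (F : Finset (Finset ℕ)) : Finset (Finset ℕ) :=
  (Icc 1 m).powerset.filter fun X => X ∈ F

/-- The subsets of `{1, …, m}` that belong to `F` after adding `m + 1`. -/
def upperPart (m : ℕ) (F : Finset (Finset ℕ)) : Finset (Finset ℕ) :=
  (Icc 1 m).powerset.filter fun X => insert (m + 1) X ∈ F

theorem mem_lowerPart {m : ℕ} {F : Finset (Finset ℕ)} {X : Finset ℕ} :
    X ∈ lowerPart m F ↔ X ⊆ Icc 1 m ∧ X ∈ F := by
  simp [lowerPart]

theorem mem_upperPart {m : ℕ} {F : Finset (Finset ℕ)} {X : Finset ℕ} :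
    X ∈ upperPart m F ↔ X ⊆ Icc 1 m ∧ insert (m + 1) X ∈ F := by
  simp [upperPart]

theorem lt_succ_of_subset_Icc {m : ℕ} {X : Finset ℕ} (hX : X ⊆ Icc 1 m) : ∀ a ∈ X, a < m + 1 :=
  fun _ ha => Nat.lt_succ_of_le (mem_Icc.1 (hX ha)).2

theorem succ_notMem_of_subset_Icc {m : ℕ} {X : Finset ℕ} (hX : X ⊆ Icc 1 m) : m + 1 ∉ X :=
  fun h => lt_irrefl _ (lt_succ_of_subset_Icc hX _ h)

theorem subset_Icc_succ_cases {m : ℕ} {X : Finset ℕ} (hX : X ⊆ Icc 1 (m + 1)) :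
    X ⊆ Icc 1 m ∨ ∃ Y ⊆ Icc 1 m, X = insert (m + 1) Y := by
  have he : ∀ a ∈ X, a ≠ m + 1 → a ∈ Icc 1 m := fun a ha hne => by
    have := mem_Icc.1 (hX ha)
    exact mem_Icc.2 ⟨this.1, by omega⟩
  by_cases h : m + 1 ∈ X
  · exact Or.inr ⟨X.erase (m + 1), fun a ha => he a (mem_of_mem_erase ha) (ne_of_mem_erase ha),
      (insert_erase h).symm⟩
  · exact Or.inl fun a ha => he a ha fun h' => h (h' ▸ ha)

theorem card_lowerPart_add_card_upperPart {m : ℕ} {F : Finset (Finset ℕ)}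
    (hF : ∀ X ∈ F, X ⊆ Icc 1 (m + 1)) :
    (lowerPart m F).card + (upperPart m F).card = F.card := by
  have hun : F = lowerPart m F ∪ (upperPart m F).image (insert (m + 1)) := by
    ext X
    simp only [mem_union, mem_image, mem_lowerPart, mem_upperPart]
    constructor
    · intro hX
      rcases subset_Icc_succ_cases (hF X hX) with h | ⟨Y, hY, rfl⟩
      · exact Or.inl ⟨h, hX⟩
      · exact Or.inr ⟨Y, ⟨hY, hX⟩, rfl⟩
    · rintro (⟨_, h⟩ | ⟨Y, ⟨_, h⟩, rfl⟩) <;> exact h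
  have hdisj : Disjoint (lowerPart m F) ((upperPart m F).image (insert (m + 1))) := by
    rw [disjoint_left]
    intro X hX hX'
    obtain ⟨Y, _, rfl⟩ := mem_image.1 hX'
    exact succ_notMem_of_subset_Icc (mem_lowerPart.1 hX).1 (mem_insert_self _ _)
  have hinj : Set.InjOn (insert (m + 1)) (upperPart m F : Set (Finset ℕ)) := by
    intro X hX Y hY h
    have hX' := succ_notMem_of_subset_Icc (mem_upperPart.1 hX).1
    have hY' := succ_notMem_of_subset_Icc (mem_upperPart.1 hY).1
    rw [← erase_insert hX', ← erase_insert hY']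
    exact congrArg (fun Z => erase Z (m + 1)) h
  conv_rhs => rw [hun]
  rw [card_union_of_disjoint hdisj, card_image_of_injOn hinj]

namespace MaxSep

variable {m : ℕ} {F : Finset (Finset ℕ)} {X Y Z : Finset ℕ}

theorem not_strictLeft (hF : MaxSep (m + 1) F) (hX : X ∈ lowerPart m F)
    (hY : Y ∈ upperPart m F) : ¬ StrictLeft Y X := by
  rw [mem_lowerPart] at hX
  rw [mem_upperPart] at hY
  exact ((sep_insert_iff (lt_succ_of_subset_Icc hX.1) (lt_succ_of_subset_Icc hY.1)).1
    (hF.sep _ hX.2 _ hY.2)).2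

theorem subset_Icc_of_mem_parts (hX : X ∈ lowerPart m F ∪ upperPart m F) : X ⊆ Icc 1 m := by
  rcases mem_union.1 hX with h | h
  · exact (mem_lowerPart.1 h).1
  · exact (mem_upperPart.1 h).1

theorem sep_parts (hF : MaxSep (m + 1) F) (hX : X ∈ lowerPart m F ∪ upperPart m F)
    (hY : Y ∈ lowerPart m F ∪ upperPart m F) : IsSep X Y := by
  have hXs := subset_Icc_of_mem_parts hX
  have hYs := subset_Icc_of_mem_parts hY
  have hXl := lt_succ_of_subset_Icc hXs
  have hYl := lt_succ_of_subset_Icc hYs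
  rcases mem_union.1 hX with h | h <;> rcases mem_union.1 hY with h' | h'
  · exact hF.sep _ (mem_lowerPart.1 h).2 _ (mem_lowerPart.1 h').2
  · exact ((sep_insert_iff hXl hYl).1
      (hF.sep _ (mem_lowerPart.1 h).2 _ (mem_upperPart.1 h').2)).1
  · exact ((sep_insert_iff hYl hXl).1
      (hF.sep _ (mem_lowerPart.1 h').2 _ (mem_upperPart.1 h).2)).1.symm
  · exact (sep_insert_insert (succ_notMem_of_subset_Icc hXs) (succ_notMem_of_subset_Icc hYs)).1
      (hF.sep _ (mem_upperPart.1 h).2 _ (mem_upperPart.1 h').2)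

theorem mem_lowerPart_of_sep (hF : MaxSep (m + 1) F) (hZ : Z ⊆ Icc 1 m)
    (hsep : ∀ X ∈ lowerPart m F ∪ upperPart m F, IsSep Z X)
    (hleft : ∀ Y ∈ upperPart m F, ¬ StrictLeft Y Z) : Z ∈ lowerPart m F := by
  refine mem_lowerPart.2 ⟨hZ, hF.mem_of_sep Z
    (hZ.trans (Icc_subset_Icc_right (Nat.le_succ m))) fun W hW => ?_⟩
  rcases subset_Icc_succ_cases (hF.subset_Icc W hW) with h | ⟨Y, hY, rfl⟩
  · exact hsep W (mem_union_left _ (mem_lowerPart.2 ⟨h, hW⟩))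
  · have hY' := mem_upperPart.2 ⟨hY, hW⟩
    exact (sep_insert_iff (lt_succ_of_subset_Icc hZ) (lt_succ_of_subset_Icc hY)).2
      ⟨hsep Y (mem_union_right _ hY'), hleft Y hY'⟩

theorem mem_upperPart_of_sep (hF : MaxSep (m + 1) F) (hZ : Z ⊆ Icc 1 m)
    (hsep : ∀ X ∈ lowerPart m F ∪ upperPart m F, IsSep Z X)
    (hleft : ∀ X ∈ lowerPart m F, ¬ StrictLeft Z X) : Z ∈ upperPart m F := by
  refine mem_upperPart.2 ⟨hZ, hF.mem_of_sep _ (insert_subset (by simp)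
    (hZ.trans (Icc_subset_Icc_right (Nat.le_succ m)))) fun W hW => ?_⟩
  rcases subset_Icc_succ_cases (hF.subset_Icc W hW) with h | ⟨Y, hY, rfl⟩
  · have hW' := mem_lowerPart.2 ⟨h, hW⟩
    exact ((sep_insert_iff (lt_succ_of_subset_Icc h) (lt_succ_of_subset_Icc hZ)).2
      ⟨(hsep W (mem_union_left _ hW')).symm, hleft W hW'⟩).symm
  · exact (sep_insert_insert (succ_notMem_of_subset_Icc hZ) (succ_notMem_of_subset_Icc hY)).2
      (hsep Y (mem_union_right _ (mem_upperPart.2 ⟨hY, hW⟩)))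

theorem parts (hF : MaxSep (m + 1) F) : MaxSep m (lowerPart m F ∪ upperPart m F) := by
  refine ⟨fun X hX => subset_Icc_of_mem_parts hX, fun X hX Y hY => hF.sep_parts hX hY, ?_⟩
  intro Z hZ hsep
  by_contra hmem
  rw [mem_union, not_or] at hmem
  have h0 := mt (hF.mem_lowerPart_of_sep hZ hsep) hmem.1
  have h1 := mt (hF.mem_upperPart_of_sep hZ hsep) hmem.2
  push Not at h0 h1
  obtain ⟨Y, hY, hYZ⟩ := h0
  obtain ⟨X, hX, hZX⟩ := h1
  exact hF.not_strictLeft hX hY (hYZ.trans hZX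
    (hF.sep_parts (mem_union_right _ hY) (mem_union_left _ hX)))

theorem inter_chain (hF : MaxSep (m + 1) F) (hX : X ∈ lowerPart m F ∩ upperPart m F)
    (hY : Y ∈ lowerPart m F ∩ upperPart m F) : X ⊆ Y ∨ Y ⊆ X := by
  rw [mem_inter] at hX hY
  rcases hF.sep_parts (mem_union_left _ hX.1) (mem_union_left _ hY.1) with h | h | h | h
  · exact Or.inl h
  · exact Or.inr h
  · exact absurd h (hF.not_strictLeft hY.1 hX.2)
  · exact absurd h (hF.not_strictLeft hX.1 hY.2)

theorem exists_strictLeft_of_notMem_upperPart (hF : MaxSep (m + 1) F) (hZ : Z ∈ lowerPart m F)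
    (hZ' : Z ∉ upperPart m F) : ∃ X ∈ lowerPart m F ∩ upperPart m F, StrictLeft Z X := by
  classical
  have hsep : ∀ W ∈ lowerPart m F, ∀ X ∈ lowerPart m F ∪ upperPart m F, IsSep W X :=
    fun W hW X hX => hF.sep_parts (mem_union_left _ hW) hX
  obtain ⟨X₀, hX₀, hlt₀⟩ : ∃ X ∈ lowerPart m F, StrictLeft Z X := by
    by_contra! h
    exact hZ' (hF.mem_upperPart_of_sep (mem_lowerPart.1 hZ).1 (hsep Z hZ) h)
  obtain ⟨X, hX, hmin⟩ := exists_min_image ((lowerPart m F).filter fun X => StrictLeft Z X)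
    (fun X => ((lowerPart m F).filter fun W => StrictLeft X W).card)
    ⟨X₀, mem_filter.2 ⟨hX₀, hlt₀⟩⟩
  rw [mem_filter] at hX
  refine ⟨X, mem_inter.2 ⟨hX.1, hF.mem_upperPart_of_sep (mem_lowerPart.1 hX.1).1
    (hsep X hX.1) fun W hW hXW => ?_⟩, hX.2⟩
  have hZW := hX.2.trans hXW (hsep Z hZ W (mem_union_left _ hW))
  refine absurd (hmin W (mem_filter.2 ⟨hW, hZW⟩)) (not_le.2 (card_lt_card ?_))
  refine (ssubset_iff_of_subset fun V hV => ?_).2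
    ⟨W, mem_filter.2 ⟨hW, hXW⟩, fun h => (mem_filter.1 h).2.1 (subset_refl W)⟩
  rw [mem_filter] at hV ⊢
  exact ⟨hV.1, hXW.trans hV.2 (hsep X hX.1 V (mem_union_left _ hV.1))⟩

theorem exists_strictLeft_of_notMem_lowerPart (hF : MaxSep (m + 1) F) (hZ : Z ∈ upperPart m F)
    (hZ' : Z ∉ lowerPart m F) : ∃ X ∈ lowerPart m F ∩ upperPart m F, StrictLeft X Z := by
  classical
  have hsep : ∀ W ∈ upperPart m F, ∀ X ∈ lowerPart m F ∪ upperPart m F, IsSep W X :=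
    fun W hW X hX => hF.sep_parts (mem_union_right _ hW) hX
  obtain ⟨X₀, hX₀, hlt₀⟩ : ∃ X ∈ upperPart m F, StrictLeft X Z := by
    by_contra! h
    exact hZ' (hF.mem_lowerPart_of_sep (mem_upperPart.1 hZ).1 (hsep Z hZ) h)
  obtain ⟨X, hX, hmin⟩ := exists_min_image ((upperPart m F).filter fun X => StrictLeft X Z)
    (fun X => ((upperPart m F).filter fun W => StrictLeft W X).card)
    ⟨X₀, mem_filter.2 ⟨hX₀, hlt₀⟩⟩
  rw [mem_filter] at hX
  refine ⟨X, mem_inter.2 ⟨hF.mem_lowerPart_of_sep (mem_upperPart.1 hX.1).1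
    (hsep X hX.1) fun W hW hWX => ?_, hX.1⟩, hX.2⟩
  have hWZ := hWX.trans hX.2 (hsep W hW Z (mem_union_right _ hZ))
  refine absurd (hmin W (mem_filter.2 ⟨hW, hWZ⟩)) (not_le.2 (card_lt_card ?_))
  refine (ssubset_iff_of_subset fun V hV => ?_).2
    ⟨W, mem_filter.2 ⟨hW, hWX⟩, fun h => (mem_filter.1 h).2.1 (subset_refl W)⟩
  rw [mem_filter] at hV ⊢
  exact ⟨hV.1, hV.2.trans hWX (hsep V hV.1 X (mem_union_right _ hX.1))⟩

theorem mem_inter_of_comparable (hF : MaxSep (m + 1) F)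
    (hZ : Z ∈ lowerPart m F ∪ upperPart m F)
    (hcomp : ∀ X ∈ lowerPart m F ∩ upperPart m F, X ⊆ Z ∨ Z ⊆ X) :
    Z ∈ lowerPart m F ∩ upperPart m F := by
  have hno : ∀ X ∈ lowerPart m F ∩ upperPart m F, ¬ StrictLeft X Z ∧ ¬ StrictLeft Z X :=
    fun X hX => by
      rcases hcomp X hX with h | h
      · exact ⟨fun h' => h'.1 h, fun h' => h'.2.1 h⟩
      · exact ⟨fun h' => h'.2.1 h, fun h' => h'.1 h⟩
  rw [mem_inter]
  by_contra hmem
  rcases mem_union.1 hZ with h | h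
  · obtain ⟨X, hX, hZX⟩ := hF.exists_strictLeft_of_notMem_upperPart h fun h' => hmem ⟨h, h'⟩
    exact (hno X hX).2 hZX
  · obtain ⟨X, hX, hXZ⟩ := hF.exists_strictLeft_of_notMem_lowerPart h fun h' => hmem ⟨h', h⟩
    exact (hno X hX).1 hXZ

theorem exists_mem_inter_card_eq (hF : MaxSep (m + 1) F)
    (hgap : GapFree (lowerPart m F ∪ upperPart m F)) {k : ℕ} (hk : k ≤ m) :
    ∃ X ∈ lowerPart m F ∩ upperPart m F, X.card = k :=
  hF.parts.exists_card_eq hgap (inter_subset_left.trans subset_union_left)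
    (fun _ hX _ hY => hF.inter_chain hX hY) (fun _ hZ h => hF.mem_inter_of_comparable hZ h) hk

theorem card_succ (hF : MaxSep (m + 1) F) (hgap : GapFree (lowerPart m F ∪ upperPart m F)) :
    F.card = (lowerPart m F ∪ upperPart m F).card + (m + 1) := by
  have hC : (lowerPart m F ∩ upperPart m F).card = m + 1 := card_eq_of_chain
    (fun X hX => (mem_lowerPart.1 (mem_inter.1 hX).1).1)
    (fun _ hX _ hY => hF.inter_chain hX hY) fun k hk => hF.exists_mem_inter_card_eq hgap hk
  rw [← card_lowerPart_add_card_upperPart hF.subset_Icc, ← card_union_add_card_inter, hC]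

theorem strictLeft_or_of_card_le {G : Finset (Finset ℕ)} (hG : MaxSep m G) (hX : X ∈ G)
    (hY : Y ∈ G) (hcard : X.card ≤ Y.card) : X ⊆ Y ∨ StrictLeft X Y ∨ StrictLeft Y X := by
  rcases hG.sep X hX Y hY with h | h | h
  · exact Or.inl h
  · exact Or.inl (eq_of_subset_of_card_le h hcard).ge
  · exact Or.inr h

theorem gap_lowerPart (hF : MaxSep (m + 1) F) (hgap : GapFree (lowerPart m F ∪ upperPart m F))
    (hX : X ∈ lowerPart m F) (hY : Y ∈ lowerPart m F) (hXY : X ⊆ Y)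
    (hcard : X.card + 2 ≤ Y.card) : ∃ Z ∈ lowerPart m F, X ⊂ Z ∧ Z ⊂ Y := by
  have hX' := mem_union_left (upperPart m F) hX
  have hY' := mem_union_left (upperPart m F) hY
  obtain ⟨Z, hZ, hXZ, hZY⟩ := hgap X hX' Y hY' hXY hcard
  by_cases hZ0 : Z ∈ lowerPart m F
  · exact ⟨Z, hZ0, hXZ, hZY⟩
  have hZ1 : Z ∈ upperPart m F := (mem_union.1 hZ).resolve_left hZ0
  have hc1 := card_lt_card hXZ
  have hc2 := card_lt_card hZY
  have hZm : Z.card ≤ m := by simpa using card_le_card (mem_upperPart.1 hZ1).1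
  obtain ⟨W, hW, hWc⟩ := hF.exists_mem_inter_card_eq hgap hZm
  rw [mem_inter] at hW
  have hW' := mem_union_left (upperPart m F) hW.1
  have hWZ : StrictLeft W Z := by
    rcases hF.parts.strictLeft_or_of_card_le hW' hZ hWc.le with h | h | h
    · exact absurd (eq_of_subset_of_card_le h hWc.ge ▸ hW.1) hZ0
    · exact h
    · exact absurd h (hF.not_strictLeft hW.1 hZ1)
  refine ⟨W, hW.1, ?_, ?_⟩
  · rcases hF.parts.strictLeft_or_of_card_le hX' hW' (by omega) with h | h | h
    · exact h.ssubset_of_ne fun h' => by subst h'; omega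
    · exact absurd hXZ.1 (h.trans hWZ (hF.sep_parts hX' hZ)).1
    · exact absurd h (hF.not_strictLeft hX hW.2)
  · rcases hF.parts.strictLeft_or_of_card_le hW' hY' (by omega) with h | h | h
    · exact h.ssubset_of_ne fun h' => by subst h'; omega
    · exact absurd h (hF.not_strictLeft hY hW.2)
    · exact absurd hZY.1 (h.trans hWZ (hF.sep_parts hY' hZ)).2.1

theorem gap_upperPart (hF : MaxSep (m + 1) F) (hgap : GapFree (lowerPart m F ∪ upperPart m F))
    (hX : X ∈ upperPart m F) (hY : Y ∈ upperPart m F) (hXY : X ⊆ Y)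
    (hcard : X.card + 2 ≤ Y.card) : ∃ Z ∈ upperPart m F, X ⊂ Z ∧ Z ⊂ Y := by
  have hX' := mem_union_right (lowerPart m F) hX
  have hY' := mem_union_right (lowerPart m F) hY
  obtain ⟨Z, hZ, hXZ, hZY⟩ := hgap X hX' Y hY' hXY hcard
  by_cases hZ1 : Z ∈ upperPart m F
  · exact ⟨Z, hZ1, hXZ, hZY⟩
  have hZ0 : Z ∈ lowerPart m F := (mem_union.1 hZ).resolve_right hZ1
  have hc1 := card_lt_card hXZ
  have hc2 := card_lt_card hZY
  have hZm : Z.card ≤ m := by simpa using card_le_card (mem_lowerPart.1 hZ0).1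
  obtain ⟨W, hW, hWc⟩ := hF.exists_mem_inter_card_eq hgap hZm
  rw [mem_inter] at hW
  have hW' := mem_union_left (upperPart m F) hW.1
  have hZW : StrictLeft Z W := by
    rcases hF.parts.strictLeft_or_of_card_le hW' hZ hWc.le with h | h | h
    · exact absurd (eq_of_subset_of_card_le h hWc.ge ▸ hW.2) hZ1
    · exact absurd h (hF.not_strictLeft hZ0 hW.2)
    · exact h
  refine ⟨W, hW.2, ?_, ?_⟩
  · rcases hF.parts.strictLeft_or_of_card_le hX' hW' (by omega) with h | h | h
    · exact h.ssubset_of_ne fun h' => by subst h'; omega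
    · exact absurd h (hF.not_strictLeft hW.1 hX)
    · exact absurd hXZ.1 (hZW.trans h (hF.sep_parts hZ hX')).2.1
  · rcases hF.parts.strictLeft_or_of_card_le hW' hY' (by omega) with h | h | h
    · exact h.ssubset_of_ne fun h' => by subst h'; omega
    · exact absurd hZY.1 (hZW.trans h (hF.sep_parts hZ hY')).1
    · exact absurd h (hF.not_strictLeft hW.1 hY)

theorem exists_between_parts (hF : MaxSep (m + 1) F)
    (hgap : GapFree (lowerPart m F ∪ upperPart m F))
    (hX : X ∈ lowerPart m F) (hY : Y ∈ upperPart m F) (hXY : X ⊂ Y) :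
    (∃ Z ∈ lowerPart m F, X ⊂ Z ∧ Z ⊆ Y) ∨ ∃ Z ∈ upperPart m F, X ⊆ Z ∧ Z ⊂ Y := by
  by_cases hY0 : Y ∈ lowerPart m F
  · exact Or.inl ⟨Y, hY0, hXY, subset_refl Y⟩
  by_cases hX1 : X ∈ upperPart m F
  · exact Or.inr ⟨X, hX1, subset_refl X, hXY⟩
  have hX' := mem_union_left (upperPart m F) hX
  have hY' := mem_union_right (lowerPart m F) hY
  have hlt := card_lt_card hXY
  by_cases hcard : X.card + 2 ≤ Y.card
  · obtain ⟨Z, hZ, hXZ, hZY⟩ := hgap X hX' Y hY' hXY.1 hcard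
    rcases mem_union.1 hZ with h | h
    · exact Or.inl ⟨Z, h, hXZ, hZY.1⟩
    · exact Or.inr ⟨Z, h, hXZ.1, hZY⟩
  exfalso
  have hYm : Y.card ≤ m := by simpa using card_le_card (mem_upperPart.1 hY).1
  obtain ⟨V, hV, hVc⟩ := hF.exists_mem_inter_card_eq hgap (hlt.le.trans hYm)
  obtain ⟨W, hW, hWc⟩ := hF.exists_mem_inter_card_eq hgap hYm
  have hVW : V ⊆ W := by
    rcases hF.inter_chain hV hW with h | h
    · exact h
    · exact (eq_of_subset_of_card_le h (by omega)).ge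
  rw [mem_inter] at hV hW
  have hV' := mem_union_left (upperPart m F) hV.1
  have hW' := mem_union_left (upperPart m F) hW.1
  have hVX : V ≠ X := fun h => hX1 (h ▸ hV.2)
  have hWY : W ≠ Y := fun h => hY0 (h ▸ hW.1)
  have hXV : StrictLeft X V := by
    rcases hF.parts.strictLeft_or_of_card_le hX' hV' hVc.ge with h | h | h
    · exact absurd (eq_of_subset_of_card_le h hVc.le).symm hVX
    · exact h
    · exact absurd h (hF.not_strictLeft hX hV.2)
  have hWYl : StrictLeft W Y := by
    rcases hF.parts.strictLeft_or_of_card_le hW' hY' hWc.le with h | h | h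
    · exact absurd (eq_of_subset_of_card_le h hWc.ge) hWY
    · exact h
    · exact absurd h (hF.not_strictLeft hW.1 hY)
  have hVY : V ⊆ Y := by
    rcases hF.parts.strictLeft_or_of_card_le hV' hY' (by omega) with h | h | h
    · exact h
    · exact absurd hXY.1 (hXV.trans h (hF.sep_parts hX' hY')).1
    · exact absurd h (hF.not_strictLeft hV.1 hY)
  have hXW : X ⊆ W := by
    rcases hF.parts.strictLeft_or_of_card_le hX' hW' (by omega) with h | h | h
    · exact h
    · exact absurd hXY.1 (h.trans hWYl (hF.sep_parts hX' hY')).1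
    · exact absurd h (hF.not_strictLeft hX hW.2)
  have hunion : X.card + 1 ≤ (X ∪ V).card := by
    refine card_lt_card (subset_union_left.ssubset_of_ne fun h => hXV.2.1 ?_)
    exact h ▸ subset_union_right
  have h1 := eq_of_subset_of_card_le (union_subset hXW hVW) (by omega)
  have h2 := eq_of_subset_of_card_le (union_subset hXY.1 hVY) (by omega)
  exact hWY (h1.symm.trans h2)

theorem gapFree_succ (hF : MaxSep (m + 1) F)
    (hgap : GapFree (lowerPart m F ∪ upperPart m F)) : GapFree F := by
  intro A hA B hB hAB hcard
  rcases subset_Icc_succ_cases (hF.subset_Icc A hA) with hAs | ⟨X, hXs, rfl⟩ <;>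
    rcases subset_Icc_succ_cases (hF.subset_Icc B hB) with hBs | ⟨Y, hYs, rfl⟩
  · obtain ⟨Z, hZ, h⟩ := hF.gap_lowerPart hgap (mem_lowerPart.2 ⟨hAs, hA⟩)
      (mem_lowerPart.2 ⟨hBs, hB⟩) hAB hcard
    exact ⟨Z, (mem_lowerPart.1 hZ).2, h⟩
  · have hAm := succ_notMem_of_subset_Icc hAs
    have hYm := succ_notMem_of_subset_Icc hYs
    rw [card_insert_of_notMem hYm] at hcard
    have hAY : A ⊂ Y := ((subset_insert_iff_of_notMem hAm).1 hAB).ssubset_of_ne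
      fun h => by subst h; omega
    rcases hF.exists_between_parts hgap (mem_lowerPart.2 ⟨hAs, hA⟩)
      (mem_upperPart.2 ⟨hYs, hB⟩) hAY with ⟨Z, hZ, h1, h2⟩ | ⟨Z, hZ, h1, h2⟩
    · rw [mem_lowerPart] at hZ
      refine ⟨Z, hZ.2, h1, h2.trans (subset_insert _ _), fun h => ?_⟩
      exact succ_notMem_of_subset_Icc hZ.1 (h (mem_insert_self _ _))
    · rw [mem_upperPart] at hZ
      refine ⟨_, hZ.2, ⟨h1.trans (subset_insert _ _), fun h => ?_⟩,
        insert_subset_insert _ h2.1, fun h => ?_⟩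
      · exact hAm (h (mem_insert_self _ _))
      · exact h2.2 ((insert_subset_insert_iff hYm).1 h)
  · exact absurd (hAB (mem_insert_self _ _)) (succ_notMem_of_subset_Icc hBs)
  · have hXm := succ_notMem_of_subset_Icc hXs
    have hYm := succ_notMem_of_subset_Icc hYs
    rw [card_insert_of_notMem hXm, card_insert_of_notMem hYm] at hcard
    obtain ⟨Z, hZ, h1, h2⟩ := hF.gap_upperPart hgap (mem_upperPart.2 ⟨hXs, hA⟩)
      (mem_upperPart.2 ⟨hYs, hB⟩) ((insert_subset_insert_iff hXm).1 hAB) (by omega)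
    rw [mem_upperPart] at hZ
    have hZm := succ_notMem_of_subset_Icc hZ.1
    exact ⟨_, hZ.2,
      ⟨insert_subset_insert _ h1.1, fun h => h1.2 ((insert_subset_insert_iff hZm).1 h)⟩,
      insert_subset_insert _ h2.1, fun h => h2.2 ((insert_subset_insert_iff hYm).1 h)⟩

theorem card_eq_and_gapFree (n : ℕ) : ∀ F : Finset (Finset ℕ), MaxSep n F →
    F.card = n * (n + 1) / 2 + 1 ∧ GapFree F := by
  induction n with
  | zero =>
    intro F hF
    have hF' : F = {∅} := by
      refine eq_singleton_iff_unique_mem.2 ⟨hF.mem_of_sep _ (empty_subset _)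
        fun Y _ => Or.inl (empty_subset _), fun X hX => ?_⟩
      simpa using hF.subset_Icc X hX
    subst hF'
    refine ⟨by simp, fun X _ Y hY _ hcard => ?_⟩
    rw [mem_singleton.1 hY] at hcard
    simp at hcard
  | succ m ih =>
    intro F hF
    obtain ⟨hcard, hgap⟩ := ih _ hF.parts
    refine ⟨?_, hF.gapFree_succ hgap⟩
    rw [hF.card_succ hgap, hcard]
    have : (m + 1) * (m + 1 + 1) = m * (m + 1) + 2 * (m + 1) := by ring
    omega

end MaxSep

/-- the hyper-cube `2^[n]` is s-pure; moreover, every maximal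
s-collection in `2^[n]` has cardinality `n(n+1)/2 + 1`. -/
theorem hypercube_s_pure (n : ℕ) (hn : 1 ≤ n) :
    SPure {X : Finset ℕ | X ⊆ Finset.Icc 1 n} ∧
    ∀ F : Finset (Finset ℕ), IsMaxSColl {X : Finset ℕ | X ⊆ Finset.Icc 1 n} F →
      F.card = n * (n + 1) / 2 + 1 := by
  have hcard : ∀ F : Finset (Finset ℕ), IsMaxSColl {X : Finset ℕ | X ⊆ Finset.Icc 1 n} F →
      F.card = n * (n + 1) / 2 + 1 := fun F hF => (MaxSep.card_eq_and_gapFree n F hF.maxSep).1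
  exact ⟨fun F G hF hG => (hcard F hF).trans (hcard G hG).symm, hcard⟩
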